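/- arXiv:2110.00544 — 4 statements merged into one kernel-verified Lean document; each statement's English description precedes it below -/
import Mathlib

section
/- For every natural number m ≥ 1 and every tuple of natural numbers k₁, …, k_m, the product of Catalan numbers satisfies C_{k₁} · C_{k₂} ⋯ C_{k_m} ≤ C_{k₁ + k₂ + ⋯ + k_m}. Formally: for any function k : Fin m → ℕ, ∏ i, catalan (k i) ≤ catalan (∑ i, k i). -/
theorem catalan_succ_range_aux (n : ℕ) :
    catalan (n + 1) = ∑ i ∈ Finset.range (n + 1), catalan i * catalan (n - i) := by
  rw [catalan_succ]
  exact Fin.sum_univ_eq_sum_range (fun i => catalan i * catalan (n - i)) (n + 1)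

theorem catalan_mul_le_aux (a b : ℕ) : catalan a * catalan b ≤ catalan (a + b) := by
  induction a using Nat.strong_induction_on with
  | _ a ih =>
    rcases a with _ | a
    · simp
    · rw [show a + 1 + b = (a + b) + 1 by omega, catalan_succ_range_aux a,
        catalan_succ_range_aux (a + b), Finset.sum_mul]
      calc ∑ i ∈ Finset.range (a + 1), catalan i * catalan (a - i) * catalan b
          ≤ ∑ i ∈ Finset.range (a + 1), catalan i * catalan (a + b - i) := by
            refine Finset.sum_le_sum fun i hi => ?_
            have hi' := Finset.mem_range.1 hi
            have h := ih (a - i) (by omega)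
            rw [show a - i + b = a + b - i by omega] at h
            rw [mul_assoc]
            exact Nat.mul_le_mul_left _ h
        _ ≤ _ := Finset.sum_le_sum_of_subset (Finset.range_mono (by omega))

/-- **Lemma (Catalan product inequality).** For `m ≥ 1` and natural numbers
`k₁, …, k_m`, we have `C_{k₁} ⋯ C_{k_m} ≤ C_{k₁ + ⋯ + k_m}`. -/
theorem catalan_prod_le_catalan_sum (m : ℕ) (hm : 1 ≤ m) (k : Fin m → ℕ) :
    ∏ i, catalan (k i) ≤ catalan (∑ i, k i) := by
  clear hm
  induction m with
  | zero => simp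
  | succ n ih =>
    rw [Fin.prod_univ_succ, Fin.sum_univ_succ]
    exact (Nat.mul_le_mul_left _ (ih _)).trans (catalan_mul_le_aux _ _)
end

section
/- For all natural numbers ℓ, d and every tuple of natural numbers m₁, …, m_ℓ, the associahedron face numbers satisfy the superadditivity inequality C(m₁ + ⋯ + m_ℓ, d) ≥ ∑ C(m₁, d₁) · C(m₂, d₂) ⋯ C(m_ℓ, d_ℓ), where the sum on the right ranges over all tuples of natural numbers (d₁, …, d_ℓ) with d₁ + ⋯ + d_ℓ = d. The inequality is an inequality of rational numbers. -/
/-- The number of `k`-dimensional faces of the `(n-1)`-dimensional associahedron: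
`C(n,k) = (1/(n+1)) · binom(n−1, k) · binom(2n−k, n)` (as a rational number),
where `n − 1` and `2n − k` use truncated subtraction on `ℕ`. -/
def assocFaceNum (n k : ℕ) : ℚ :=
  (1 / ((n : ℚ) + 1)) * ((n - 1).choose k : ℚ) * ((2 * n - k).choose n : ℚ)
lemma afn_form (a k : ℕ) : assocFaceNum (a + k + 1) k =
    ((2 * a + k + 2).factorial : ℚ) / ((a + k + 2) * (a + k + 1) * k.factorial * a.factorial *
      (a + 1).factorial) := by
  unfold assocFaceNum
  have e1 : a + k + 1 - 1 = a + k := by omega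
  have e2 : 2 * (a + k + 1) - k = 2 * a + k + 2 := by omega
  rw [e1, e2, Nat.cast_choose ℚ (show k ≤ a + k by omega),
    Nat.cast_choose ℚ (show a + k + 1 ≤ 2 * a + k + 2 by omega)]
  have e3 : a + k - k = a := by omega
  have e4 : 2 * a + k + 2 - (a + k + 1) = a + 1 := by omega
  rw [e3, e4, Nat.factorial_succ (a + k)]
  push_cast
  have : ((a : ℚ) + k + 1 + 1) ≠ 0 := by positivity
  have : ((a : ℚ) + k + 2) ≠ 0 := by positivity
  have : ((a : ℚ) + k + 1) ≠ 0 := by positivity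
  field_simp
  ring

lemma afn_zero (n k : ℕ) (h : n < k + 1) (h' : 0 < n ∨ 0 < k) : assocFaceNum n k = 0 := by
  unfold assocFaceNum
  rw [Nat.choose_eq_zero_of_lt (show n - 1 < k by omega)]
  simp

lemma rec0 (n : ℕ) : ((n : ℚ) + 3) * assocFaceNum (n + 2) 0 =
    (2 * n + 3) * (2 * assocFaceNum (n + 1) 0) := by
  have h1 := afn_form (n + 1) 0
  have h2 := afn_form n 0
  simp only [Nat.cast_zero, add_zero] at h1 h2
  rw [h1, h2]
  simp only [show 2 * (n + 1) + 2 = 2 * n + 2 + 1 + 1 by omega, show n + 1 + 1 = n + 2 by omega,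
    Nat.factorial_succ]
  push_cast
  field_simp
  ring

lemma rec1 (n : ℕ) : ((n : ℚ) + 3) * assocFaceNum (n + 2) 1 =
    (2 * n + 3) * (2 * assocFaceNum (n + 1) 1 + assocFaceNum (n + 1) 0) := by
  rcases n with _ | a
  · norm_num [assocFaceNum, Nat.choose]
  have h1 := afn_form (a + 1) 1
  have h2 := afn_form a 1
  have h3 := afn_form (a + 1) 0
  simp only [Nat.cast_zero, add_zero] at h1 h2 h3
  rw [show a + 1 + 2 = a + 1 + 1 + 1 by omega, h1, h2, h3]
  simp only [show 2 * (a + 1) + 1 + 2 = 2 * a + 2 + 1 + 1 + 1 by omega,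
    show 2 * (a + 1) + 2 = 2 * a + 2 + 1 + 1 by omega,
    show 2 * a + 1 + 2 = 2 * a + 2 + 1 by omega, Nat.factorial_succ]
  push_cast
  field_simp
  ring

lemma rec2 (n k : ℕ) : ((n : ℚ) + 3) * assocFaceNum (n + 2) (k + 2) + n * assocFaceNum n k =
    (2 * n + 3) * (2 * assocFaceNum (n + 1) (k + 2) + assocFaceNum (n + 1) (k + 1)) := by
  rcases lt_trichotomy n (k + 1) with h | h | h
  · rw [afn_zero (n + 2) (k + 2) (by omega) (by omega), afn_zero (n + 1) (k + 2) (by omega) (by omega),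
      afn_zero (n + 1) (k + 1) (by omega) (by omega)]
    rcases Nat.eq_zero_or_pos n with h0 | h0
    · simp [h0]
    · rw [afn_zero n k h (Or.inl h0)]; simp
  · subst h
    rw [afn_zero (k + 1 + 1) (k + 2) (by omega) (by omega)]
    have h1 := afn_form 0 (k + 2)
    have h2 := afn_form 0 (k + 1)
    have h3 := afn_form 0 k
    simp only [Nat.cast_zero, zero_add, Nat.mul_zero] at h1 h2 h3
    rw [show k + 1 + 2 = k + 2 + 1 by omega, h1, h2, h3]
    simp only [show k + 2 + 2 = k + 1 + 1 + 1 + 1 by omega, show k + 1 + 2 = k + 1 + 1 + 1 by omega,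
      show k + 2 = k + 1 + 1 by omega, Nat.factorial_succ]
    push_cast
    field_simp
    ring
  · obtain ⟨a, rfl⟩ : ∃ a, n = a + k + 2 := ⟨n - k - 2, by omega⟩
    have h1 := afn_form (a + 1) (k + 2)
    have h2 := afn_form a (k + 2)
    have h3 := afn_form (a + 1) (k + 1)
    have h4 := afn_form (a + 1) k
    rw [show a + 1 + (k + 2) + 1 = a + k + 2 + 2 by omega] at h1
    rw [show a + (k + 2) + 1 = a + k + 2 + 1 by omega] at h2
    rw [show a + 1 + (k + 1) + 1 = a + k + 2 + 1 by omega] at h3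
    rw [show a + 1 + k + 1 = a + k + 2 by omega] at h4
    rw [h1, h2, h3, h4]
    simp only [show 2 * (a + 1) + (k + 2) + 2 = 2 * a + k + 4 + 1 + 1 by omega,
      show 2 * a + (k + 2) + 2 = 2 * a + k + 4 by omega,
      show 2 * (a + 1) + (k + 1) + 2 = 2 * a + k + 4 + 1 by omega,
      show 2 * (a + 1) + k + 2 = 2 * a + k + 4 by omega,
      show a + k + 2 + 2 = a + k + 2 + 1 + 1 by omega,
      show k + 2 = k + 1 + 1 by omega,
      Nat.factorial_succ]
    push_cast
    field_simp
    ring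

open PowerSeries in
lemma tuple_coeff (ℓ : ℕ) : ∀ (d : ℕ) (f : Fin ℓ → ℕ → ℚ),
    ∑ δ ∈ Finset.Nat.antidiagonalTuple ℓ d, ∏ i, f i (δ i) =
      coeff d (∏ i, (PowerSeries.mk (f i) : ℚ⟦X⟧)) := by
  induction ℓ with
  | zero =>
    intro d f
    rcases d with _ | d
    · simp
    · simp [PowerSeries.coeff_one]
  | succ ℓ ih =>
    intro d f
    rw [Fin.prod_univ_succ, PowerSeries.coeff_mul]
    simp_rw [← ih, PowerSeries.coeff_mk, Finset.mul_sum]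
    rw [Finset.sum_sigma']
    refine Finset.sum_bij' (fun δ _ => ⟨(δ 0, ∑ i, Fin.tail δ i), Fin.tail δ⟩)
      (fun p _ => Fin.cons p.1.1 p.2) ?_ ?_ ?_ ?_ ?_
    · intro δ h
      simp only [Finset.Nat.mem_antidiagonalTuple, Fin.sum_univ_succ] at h
      simp [Finset.Nat.mem_antidiagonalTuple, Fin.tail, h]
    · rintro ⟨⟨a, b⟩, δ⟩ h
      simp only [Finset.mem_sigma, Finset.HasAntidiagonal.mem_antidiagonal, Finset.Nat.mem_antidiagonalTuple] at h
      simp [Finset.Nat.mem_antidiagonalTuple, Fin.sum_univ_succ, h]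
    · intro δ h
      simp
    · rintro ⟨⟨a, b⟩, δ⟩ h
      simp only [Finset.mem_sigma, Finset.HasAntidiagonal.mem_antidiagonal, Finset.Nat.mem_antidiagonalTuple] at h
      obtain ⟨h1, rfl⟩ := h
      simp
    · intro δ h
      simp [Fin.prod_univ_succ, Fin.tail]

/-- Face polynomial, as a power series. -/
noncomputable def facePS (n : ℕ) : PowerSeries ℚ := PowerSeries.mk (assocFaceNum n)

lemma facePS_zero : facePS 0 = 1 := by
  ext k
  rcases k with _ | k <;> simp [facePS, assocFaceNum, PowerSeries.coeff_one]

lemma facePS_one : facePS 1 = 1 := by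
  ext k
  rcases k with _ | k <;> simp [facePS, assocFaceNum, PowerSeries.coeff_one]
  norm_num

lemma facePS_rec (n : ℕ) :
    ((n : PowerSeries ℚ) + 3) * facePS (n + 2) + (n : PowerSeries ℚ) * (PowerSeries.X * (PowerSeries.X * facePS n)) =
      (2 * (n : PowerSeries ℚ) + 3) * (2 * facePS (n + 1) + PowerSeries.X * facePS (n + 1)) := by
  have e1 : ((n : PowerSeries ℚ) + 3) = PowerSeries.C ((n : ℚ) + 3) := by simp only [map_add, map_mul, map_natCast, map_ofNat]
  have e2 : (2 * (n : PowerSeries ℚ) + 3) = PowerSeries.C (2 * (n : ℚ) + 3) := by simp only [map_add, map_mul, map_natCast, map_ofNat]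
  have e3 : (n : PowerSeries ℚ) = PowerSeries.C (n : ℚ) := by simp
  have e4 : (2 : PowerSeries ℚ) * facePS (n + 1) = PowerSeries.C (2 : ℚ) * facePS (n + 1) := by simp only [map_add, map_mul, map_natCast, map_ofNat]
  rw [e1, e2, e3, e4]
  ext k
  rw [map_add, PowerSeries.coeff_C_mul, PowerSeries.coeff_C_mul, PowerSeries.coeff_C_mul, map_add,
    PowerSeries.coeff_C_mul]
  rcases k with _ | _ | k
  · simpa [facePS] using rec0 n
  · have := rec1 n
    simp only [zero_add, PowerSeries.coeff_succ_X_mul, PowerSeries.coeff_zero_X_mul]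
    simpa [facePS] using this
  · simp only [PowerSeries.coeff_succ_X_mul]
    simpa [facePS] using rec2 n k

/-- The square root of the discriminant. -/
noncomputable def sqrtPS : PowerSeries (PowerSeries ℚ) :=
  PowerSeries.mk fun n => match n with
    | 0 => -1
    | 1 => 2 + PowerSeries.X
    | n + 2 => 2 * (1 + PowerSeries.X) * facePS (n + 1)

/-- The discriminant. -/
noncomputable def discPS : PowerSeries (PowerSeries ℚ) :=
  1 - PowerSeries.C (2 * PowerSeries.X + 4) * PowerSeries.X
    + PowerSeries.C (PowerSeries.X ^ 2) * (PowerSeries.X * PowerSeries.X)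

lemma discPS_deriv : PowerSeries.derivative (PowerSeries ℚ) discPS =
    - PowerSeries.C (2 * PowerSeries.X + 4)
      + PowerSeries.C (PowerSeries.X ^ 2) * (2 * PowerSeries.X) := by
  unfold discPS
  simp only [map_add, map_sub, Derivation.leibniz, PowerSeries.derivative_X,
    PowerSeries.derivative_C, PowerSeries.derivative_one, smul_eq_mul]
  ring

lemma sqrtPS_ode : 2 * discPS * PowerSeries.derivative (PowerSeries ℚ) sqrtPS =
    PowerSeries.derivative (PowerSeries ℚ) discPS * sqrtPS := by
  rw [discPS_deriv, discPS]
  set S' := PowerSeries.derivative (PowerSeries ℚ) sqrtPS with hS'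
  have e : ∀ n, PowerSeries.coeff n S' = PowerSeries.coeff (n + 1) sqrtPS * ((n : PowerSeries ℚ) + 1) := by
    intro n
    rw [hS', PowerSeries.coeff_derivative]
  have l : 2 * (1 - PowerSeries.C (2 * PowerSeries.X + 4) * PowerSeries.X
    + PowerSeries.C (PowerSeries.X ^ 2) * (PowerSeries.X * PowerSeries.X)) * S' =
    PowerSeries.C 2 * S' - PowerSeries.C (2 * (2 * PowerSeries.X + 4)) * (PowerSeries.X * S')
    + PowerSeries.C (2 * PowerSeries.X ^ 2) * (PowerSeries.X * (PowerSeries.X * S')) := by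
    simp only [map_mul, map_ofNat]
    ring
  have r : (- PowerSeries.C (2 * PowerSeries.X + 4)
      + PowerSeries.C (PowerSeries.X ^ 2) * (2 * PowerSeries.X)) * sqrtPS =
      - (PowerSeries.C (2 * PowerSeries.X + 4) * sqrtPS)
      + PowerSeries.C (2 * PowerSeries.X ^ 2) * (PowerSeries.X * sqrtPS) := by
    simp only [map_mul, map_ofNat]
    ring
  rw [l, r]
  clear l r
  generalize hc : (2 * PowerSeries.X + 4 : PowerSeries ℚ) = c
  refine PowerSeries.ext fun n => ?_
  simp only [map_add, map_sub, map_neg, PowerSeries.coeff_C_mul]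
  subst hc
  rcases n with _ | _ | _ | n
  · simp only [PowerSeries.coeff_zero_X_mul, e, sqrtPS, PowerSeries.coeff_mk]
    push_cast
    ring
  · simp only [zero_add, PowerSeries.coeff_succ_X_mul, PowerSeries.coeff_zero_X_mul, e, sqrtPS,
      PowerSeries.coeff_mk, facePS_one]
    push_cast
    ring
  · simp only [zero_add, PowerSeries.coeff_succ_X_mul, PowerSeries.coeff_zero_X_mul, e, sqrtPS,
      PowerSeries.coeff_mk, facePS_one]
    have := facePS_rec 0
    simp only [zero_add, facePS_one, facePS_zero] at this
    push_cast at this ⊢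
    linear_combination 4 * (1 + PowerSeries.X) * this
  · simp only [PowerSeries.coeff_succ_X_mul, e, sqrtPS,
      PowerSeries.coeff_mk]
    have := facePS_rec (n + 1)
    push_cast at this ⊢
    linear_combination 4 * (1 + PowerSeries.X) * this

lemma sq_of_ode {R : Type*} [CommRing R] [IsAddTorsionFree R] (S D : PowerSeries R)
    (ode : 2 * D * PowerSeries.derivative R S = PowerSeries.derivative R D * S)
    (hS : PowerSeries.constantCoeff S = -1)
    (hD : PowerSeries.constantCoeff D = 1) : S ^ 2 = D := by
  obtain ⟨E, hE⟩ : ∃ E, D * E = 1 :=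
    ⟨_, PowerSeries.mul_invOfUnit D 1 (by simpa using hD)⟩
  have hE' := congrArg (PowerSeries.derivative R) hE
  rw [Derivation.leibniz, PowerSeries.derivative_one] at hE'
  simp only [smul_eq_mul] at hE'
  have key : S ^ 2 * E = 1 := by
    apply PowerSeries.derivative.ext
    · rw [Derivation.leibniz, PowerSeries.derivative_pow, PowerSeries.derivative_one]
      simp only [smul_eq_mul]
      norm_num
      set S' := PowerSeries.derivative R S
      set D' := PowerSeries.derivative R D
      set E' := PowerSeries.derivative R E
      linear_combination (E * E * S) * ode + S ^ 2 * E * hE'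
        - (S ^ 2 * E' + 2 * S * S' * E) * hE
    · have h2 : PowerSeries.constantCoeff E = 1 := by
        have := congrArg PowerSeries.constantCoeff hE
        rw [map_mul, hD] at this
        simpa using this
      simp [h2, hS]
  linear_combination D * key - S ^ 2 * hE

lemma torsionFreePS : IsAddTorsionFree (PowerSeries ℚ) := by
  constructor
  intro n hn f g h
  ext k
  have : PowerSeries.coeff k (n • f) = PowerSeries.coeff k (n • g) := congrArg _ h
  rw [map_nsmul, map_nsmul, nsmul_eq_mul, nsmul_eq_mul] at this
  exact mul_left_cancel₀ (Nat.cast_ne_zero.mpr hn : (n : ℚ) ≠ 0) this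

lemma sqrtPS_sq : sqrtPS ^ 2 = discPS := by
  have := torsionFreePS
  apply sq_of_ode _ _ sqrtPS_ode
  · rw [← PowerSeries.coeff_zero_eq_constantCoeff_apply]
    simp [sqrtPS]
  · simp [discPS]

lemma quad : PowerSeries.mk facePS =
    1 + PowerSeries.X * (PowerSeries.C (1 + PowerSeries.X) * (PowerSeries.mk facePS * PowerSeries.mk facePS)
      - PowerSeries.C PowerSeries.X * PowerSeries.mk facePS) := by
  set A : PowerSeries (PowerSeries ℚ) := PowerSeries.mk facePS with hA
  set x : PowerSeries (PowerSeries ℚ) := PowerSeries.C PowerSeries.X with hx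
  have hS : sqrtPS = PowerSeries.C (2 * (1 + PowerSeries.X)) * (PowerSeries.X * A)
      - PowerSeries.C PowerSeries.X * PowerSeries.X - 1 := by
    refine PowerSeries.ext fun n => ?_
    simp only [map_sub, PowerSeries.coeff_C_mul]
    rcases n with _ | _ | n
    · simp [sqrtPS]
    · simp only [zero_add, PowerSeries.coeff_succ_X_mul, sqrtPS, PowerSeries.coeff_mk, hA,
        facePS_zero, PowerSeries.coeff_one_X, PowerSeries.coeff_one]
      norm_num
      ring
    · simp [PowerSeries.coeff_succ_X_mul, sqrtPS, PowerSeries.coeff_mk, hA,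
        PowerSeries.coeff_X, PowerSeries.coeff_one]
  have h := sqrtPS_sq
  rw [hS, discPS] at h
  simp only [map_mul, map_add, map_ofNat, map_one, map_pow, ← hx] at h ⊢
  have hne : (4 : PowerSeries (PowerSeries ℚ)) * PowerSeries.X * (1 + x) ≠ 0 := by
    refine mul_ne_zero (mul_ne_zero ?_ PowerSeries.X_ne_zero) ?_
    · intro h0
      have := congrArg PowerSeries.constantCoeff (congrArg PowerSeries.constantCoeff h0)
      simp only [map_ofNat, map_zero] at this
      norm_num at this
    · intro h0
      have := congrArg PowerSeries.constantCoeff (congrArg PowerSeries.constantCoeff h0)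
      simp [hx] at this
  apply mul_left_cancel₀ hne
  linear_combination -h

lemma facePS_conv (n : ℕ) : facePS (n + 1) = facePS n +
    (1 + PowerSeries.X) * ∑ i ∈ Finset.range n, facePS (i + 1) * facePS (n - 1 - i) := by
  have h := congrArg (PowerSeries.coeff (n + 1)) quad
  rw [map_add, PowerSeries.coeff_succ_X_mul, map_sub, PowerSeries.coeff_C_mul,
    PowerSeries.coeff_C_mul, PowerSeries.coeff_mul, PowerSeries.coeff_one,
    Finset.Nat.sum_antidiagonal_eq_sum_range_succ_mk, Finset.sum_range_succ'] at h
  simp only [PowerSeries.coeff_mk, facePS_zero] at h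
  have e : ∀ i, n - 1 - i = n - (i + 1) := by intro i; omega
  simp only [e]
  rw [h]
  simp
  ring

/-- Power series with nonnegative coefficients. -/
def nonnegPS : Subsemiring (PowerSeries ℚ) where
  carrier := {f | ∀ k, 0 ≤ PowerSeries.coeff k f}
  mul_mem' := by
    intro f g hf hg k
    rw [PowerSeries.coeff_mul]
    exact Finset.sum_nonneg fun p _ => mul_nonneg (hf _) (hg _)
  one_mem' := by
    intro k
    rw [PowerSeries.coeff_one]
    split_ifs <;> norm_num
  add_mem' := by
    intro f g hf hg k
    rw [map_add]
    exact add_nonneg (hf k) (hg k)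
  zero_mem' := by
    intro k
    simp

lemma facePS_mem (n : ℕ) : facePS n ∈ nonnegPS := by
  intro k
  simp only [facePS, PowerSeries.coeff_mk, assocFaceNum]
  positivity

lemma one_add_X_mem : (1 + PowerSeries.X : PowerSeries ℚ) ∈ nonnegPS := by
  refine add_mem (one_mem _) ?_
  intro k
  rw [PowerSeries.coeff_X]
  split_ifs <;> norm_num

lemma facePS_super (m : ℕ) : ∀ n, facePS (m + n) - facePS m * facePS n ∈ nonnegPS := by
  induction m using Nat.strong_induction_on with
  | _ m ih =>
    intro n
    rcases m with _ | m
    · simp [facePS_zero, zero_mem]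
    have e : facePS (m + 1 + n) - facePS (m + 1) * facePS n =
        (facePS (m + n) - facePS m * facePS n) + (1 + PowerSeries.X) *
        (∑ i ∈ Finset.range m, facePS (i + 1) *
            (facePS (m - 1 - i + n) - facePS (m - 1 - i) * facePS n) +
          ∑ i ∈ Finset.range n, facePS (m + i + 1) * facePS (m + n - 1 - (m + i))) := by
      rw [show m + 1 + n = m + n + 1 by omega, facePS_conv (m + n), facePS_conv m,
        Finset.sum_range_add]
      have e2 : ∑ i ∈ Finset.range m, facePS (i + 1) * facePS (m + n - 1 - i) =
          ∑ i ∈ Finset.range m, facePS (i + 1) * facePS (m - 1 - i + n) := by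
        refine Finset.sum_congr rfl fun i hi => ?_
        rw [Finset.mem_range] at hi
        rw [show m + n - 1 - i = m - 1 - i + n by omega]
      rw [e2]
      simp only [mul_sub, Finset.sum_sub_distrib, ← mul_assoc, ← Finset.sum_mul]
      ring
    rw [e]
    refine add_mem (ih m (by omega) n) (mul_mem one_add_X_mem (add_mem ?_ ?_))
    · exact sum_mem fun i hi => mul_mem (facePS_mem _) (ih _ (by omega) n)
    · exact sum_mem fun i hi => mul_mem (facePS_mem _) (facePS_mem _)

lemma facePS_prod (ℓ : ℕ) : ∀ m : Fin ℓ → ℕ,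
    facePS (∑ i, m i) - ∏ i, facePS (m i) ∈ nonnegPS := by
  induction ℓ with
  | zero => intro m; simp [facePS_zero, zero_mem]
  | succ ℓ ih =>
    intro m
    rw [Fin.sum_univ_succ, Fin.prod_univ_succ]
    have := add_mem (facePS_super (m 0) (∑ i : Fin ℓ, m i.succ))
      (mul_mem (facePS_mem (m 0)) (ih fun i => m i.succ))
    convert this using 1
    ring

/-- **Lemma (superadditivity of associahedron face numbers).** For natural numbers
`ℓ, d` and `m₁, …, m_ℓ`, we have
`C(m₁ + ⋯ + m_ℓ, d) ≥ ∑_{d₁ + ⋯ + d_ℓ = d} C(m₁, d₁) ⋯ C(m_ℓ, d_ℓ)`. -/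
theorem assocFaceNum_superadditive (ℓ d : ℕ) (m : Fin ℓ → ℕ) :
    ∑ δ ∈ Finset.Nat.antidiagonalTuple ℓ d, ∏ i, assocFaceNum (m i) (δ i)
      ≤ assocFaceNum (∑ i, m i) d := by

  rw [tuple_coeff ℓ d fun i => assocFaceNum (m i)]
  have h := facePS_prod ℓ m d
  rw [map_sub, sub_nonneg] at h
  simpa [facePS] using h
end

section
/- For all natural numbers n and k, the number n + 1 divides the product binom(n−1, k) · binom(2n−k, n) of binomial coefficients (with n−1 and 2n−k interpreted via truncated subtraction on ℕ). Equivalently, the associahedron face number C(n,k) = binom(n−1,k) · binom(2n−k,n)/(n+1) is an integer. -/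
/-- **Integrality of associahedron face numbers.** For all natural numbers `n` and `k`,
`n + 1` divides `binom(n−1, k) · binom(2n−k, n)` (truncated subtraction on `ℕ`);
equivalently `C(n,k) = binom(n−1,k) · binom(2n−k,n) / (n+1)` is an integer. -/
theorem succ_dvd_choose_mul_choose (n k : ℕ) :
    (n + 1) ∣ (n - 1).choose k * (2 * n - k).choose n := by
  rcases n with _ | m
  · simp
  · have h1 := Nat.choose_mul_succ_eq m k
    have h2 := Nat.choose_succ_right_eq (2 * (m + 1) - k) (m + 1)
    have h3 : 2 * (m + 1) - k - (m + 1) = m + 1 - k := by omega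
    rw [h3] at h2
    have hc : Nat.Coprime (m + 1 + 1) (m + 1) := by simp
    refine hc.dvd_of_dvd_mul_left ⟨(m + 1).choose k * (2 * (m + 1) - k).choose (m + 1 + 1), ?_⟩
    rw [Nat.add_sub_cancel]
    calc (m + 1) * (m.choose k * (2 * (m + 1) - k).choose (m + 1))
        = (m.choose k * (m + 1)) * (2 * (m + 1) - k).choose (m + 1) := by ring
      _ = (m + 1).choose k * ((2 * (m + 1) - k).choose (m + 1) * (m + 1 - k)) := by
          rw [h1]; ring
      _ = _ := by rw [← h2]; ring
end

section
/- Let 𝒜 be a finite set of n ≥ 4 points in ℝ² in general position (no three points collinear). Let A ∈ 𝒜 be an extreme point of the convex hull of 𝒜, and enumerate 𝒜 \ {A} as P₀, P₁, …, P_{n−2} in counterclockwise angular order as seen from A, i.e., for all i < j the determinant of the pair of vectors (P_i − A, P_j − A) is strictly positive; here P₀ = B and P_{n−2} = C are the two vertices of the convex hull adjacent to A. For each subset S ⊆ {0, 1, …, n−2} containing both 0 and n−2, define a sign vector σ_S : {1, …, n−3} → {−1, +1} as follows: given i ∈ {1, …, n−3}, let a_l and a_r be determined by: if i ∈ S, then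 a_l and a_r are the predecessor and successor of i in S (the largest element of S smaller than i and the smallest element of S larger than i); if i ∉ S, then a_l = max{a ∈ S : a < i} and a_r = min{a ∈ S : a > i}. Set σ_S(i) = +1 if either (i ∈ S and the closed segment [A, P_i] meets the closed segment [P_{a_l}, P_{a_r}]) or (i ∉ S and the closed segment [A, P_i] does not meet the closed segment [P_{a_l}, P_{a_r}]); otherwise σ_S(i) = −1. Then the map S ↦ σ_S is a bijection from the collection of subsets of {0, …, n−2} containing 0 and n−2 onto the set of all sign vectors {−1, +1}^{ {1,…,n−3} }. -/
open scoped Classical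

namespace PolySig

noncomputable def aL (S : Finset ℕ) (i : ℕ) : ℕ := sSup {a ∈ (S : Set ℕ) | a < i}
noncomputable def aR (S : Finset ℕ) (i : ℕ) : ℕ := sInf {a ∈ (S : Set ℕ) | i < a}

lemma aL_spec (S : Finset ℕ) (i : ℕ) (h0 : 0 ∈ S) (hi : 0 < i) :
    aL S i ∈ S ∧ aL S i < i ∧ ∀ a ∈ S, a < i → a ≤ aL S i := by
  have hb : BddAbove {a ∈ (S : Set ℕ) | a < i} := ⟨i, fun a ha => ha.2.le⟩
  have hm : aL S i ∈ {a ∈ (S : Set ℕ) | a < i} :=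
    Nat.sSup_mem ⟨0, by simpa using h0, hi⟩ hb
  exact ⟨by simpa using hm.1, hm.2, fun a ha hai => le_csSup hb ⟨by simpa using ha, hai⟩⟩

lemma aR_spec (S : Finset ℕ) (i m : ℕ) (h0 : m ∈ S) (hi : i < m) :
    aR S i ∈ S ∧ i < aR S i ∧ ∀ a ∈ S, i < a → aR S i ≤ a := by
  have hm : aR S i ∈ {a ∈ (S : Set ℕ) | i < a} :=
    Nat.sInf_mem ⟨m, by simpa using h0, hi⟩
  exact ⟨by simpa using hm.1, hm.2, fun a ha hai => Nat.sInf_le ⟨by simpa using ha, hai⟩⟩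

/-- The point `i` lies above (weakly) the chord of its neighbours in `S`. -/
def up (x h : ℕ → ℝ) (S : Finset ℕ) (i : ℕ) : Prop :=
  h (aL S i) * (x (aR S i) - x i) + h (aR S i) * (x i - x (aL S i))
    ≤ h i * (x (aR S i) - x (aL S i))

/-- Discrete second difference. -/
def D (x F : ℕ → ℝ) (i : ℕ) : ℝ :=
  F (i-1) * (x (i+1) - x i) + F (i+1) * (x i - x (i-1)) - F i * (x (i+1) - x (i-1))

/-- The polyline as a function. -/
noncomputable def F (x h : ℕ → ℝ) (S : Finset ℕ) (i : ℕ) : ℝ :=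
  if i ∈ S then h i else
    (h (aL S i) * (x (aR S i) - x i) + h (aR S i) * (x i - x (aL S i)))
      / (x (aR S i) - x (aL S i))

lemma F_mem (x h : ℕ → ℝ) (S : Finset ℕ) (i : ℕ) (hi : i ∈ S) : F x h S i = h i := by
  simp [F, hi]

lemma F_consec (m : ℕ) (x h : ℕ → ℝ) (hx : ∀ i j, i < j → j ≤ m → x i < x j)
    (S : Finset ℕ) (h0 : 0 ∈ S) (hm : m ∈ S) (hS : ∀ a ∈ S, a ≤ m)
    (a b : ℕ) (hab : a < b) (ha : a ∈ S) (hb : b ∈ S) (hc : ∀ c ∈ S, a < c → b ≤ c)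
    (j : ℕ) (haj : a ≤ j) (hjb : j ≤ b) :
    F x h S j * (x b - x a) = h a * (x b - x j) + h b * (x j - x a) := by
  rcases haj.eq_or_lt with rfl | haj
  · rw [F_mem _ _ _ _ ha]; ring
  rcases hjb.eq_or_lt with rfl | hjb
  · rw [F_mem _ _ _ _ hb]; ring
  have hjS : j ∉ S := fun hj => absurd (hc j hj haj) (by omega)
  have hbm := hS b hb
  obtain ⟨l1, l2, l3⟩ := aL_spec S j h0 (by omega)
  obtain ⟨r1, r2, r3⟩ := aR_spec S j m hm (by omega)
  have hl : aL S j = a := by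
    have := l3 a ha haj
    by_contra hne
    have := hc _ l1 (by omega)
    omega
  have hr : aR S j = b := by
    have := r3 b hb hjb
    have := hc _ r1 (by omega)
    omega
  have := hx a b hab hbm
  have : x b - x a ≠ 0 := by linarith
  simp only [F, hjS, if_false, hl, hr]
  field_simp

lemma F_facts (m : ℕ) (x h : ℕ → ℝ) (hx : ∀ i j, i < j → j ≤ m → x i < x j)
    (hne : ∀ l i r, l < i → i < r → r ≤ m →
      h l * (x r - x i) + h r * (x i - x l) ≠ h i * (x r - x l))
    (S : Finset ℕ) (h0 : 0 ∈ S) (hm : m ∈ S) (hS : ∀ a ∈ S, a ≤ m)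
    (i : ℕ) (hi : 0 < i) (him : i < m) :
    (D x (F x h S) i < 0 → i ∈ S ∧ up x h S i) ∧
    (0 < D x (F x h S) i → i ∈ S ∧ ¬ up x h S i) ∧
    (i ∉ S → F x h S i < h i → up x h S i) ∧
    (i ∉ S → h i < F x h S i → ¬ up x h S i) ∧
    (i ∉ S → F x h S i ≠ h i) := by
  obtain ⟨l1, l2, l3⟩ := aL_spec S i h0 (by omega)
  obtain ⟨r1, r2, r3⟩ := aR_spec S i m hm (by omega)
  have hn := hne _ _ _ l2 r2 (hS _ r1)
  unfold up D
  generalize aL S i = l at *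
  generalize aR S i = r at *
  have hrm := hS r r1
  have xl := hx l i l2 him.le
  have xr := hx i r r2 hrm
  have x1 := hx (i-1) i (by omega) him.le
  have x2 := hx i (i+1) (by omega) (by omega)
  by_cases hiS : i ∈ S
  · have e1 := F_consec m x h hx S h0 hm hS l i l2 l1 hiS
      (fun c hc hlc => by by_contra hh; have := l3 c hc (by omega); omega) (i-1) (by omega) (by omega)
    have e2 := F_consec m x h hx S h0 hm hS i r r2 hiS r1
      (fun c hc hlc => r3 c hc hlc) (i+1) (by omega) (by omega)
    have e0 := F_mem x h S i hiS
    generalize F x h S i = f0 at *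
    generalize F x h S (i-1) = f1 at *
    generalize F x h S (i+1) = f2 at *
    subst e0
    have key : (f1 * (x (i+1) - x i) + f2 * (x i - x (i-1)) - h i * (x (i+1) - x (i-1)))
        * ((x i - x l) * (x r - x i)) =
        (h l * (x r - x i) + h r * (x i - x l) - h i * (x r - x l)) *
          ((x (i+1) - x i) * (x i - x (i-1))) := by
      linear_combination (x (i+1) - x i) * (x r - x i) * e1 + (x i - x (i-1)) * (x i - x l) * e2
    have p1 : 0 < (x i - x l) * (x r - x i) := mul_pos (by linarith) (by linarith)
    have p2 : 0 < (x (i+1) - x i) * (x i - x (i-1)) := mul_pos (by linarith) (by linarith)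
    refine ⟨fun hd => ⟨hiS, ?_⟩, fun hd => ⟨hiS, ?_⟩, fun hh => absurd hiS hh,
      fun hh => absurd hiS hh, fun hh => absurd hiS hh⟩
    · have := mul_neg_of_neg_of_pos hd p1
      rw [key] at this
      have := (pos_iff_neg_of_mul_neg this)
      by_contra hcon
      push Not at hcon
      nlinarith [mul_pos (sub_pos.2 hcon) p2]
    · have := mul_pos hd p1
      rw [key] at this
      intro hcon
      nlinarith [mul_nonneg (sub_nonneg.2 hcon) p2.le]
  · have hc : ∀ c ∈ S, l < c → r ≤ c := fun c hc hlc => by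
      rcases lt_trichotomy c i with hh | hh | hh
      · have := l3 c hc hh; omega
      · exact absurd (hh ▸ hc) hiS
      · exact r3 c hc hh
    have lr : l < r := by omega
    have e0 := F_consec m x h hx S h0 hm hS l r lr l1 r1 hc i (by omega) (by omega)
    have e1 := F_consec m x h hx S h0 hm hS l r lr l1 r1 hc (i-1) (by omega) (by omega)
    have e2 := F_consec m x h hx S h0 hm hS l r lr l1 r1 hc (i+1) (by omega) (by omega)
    have p : 0 < x r - x l := by linarith
    generalize F x h S i = f0 at *
    generalize F x h S (i-1) = f1 at *
    generalize F x h S (i+1) = f2 at *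
    have key : f1 * (x (i+1) - x i) + f2 * (x i - x (i-1)) - f0 * (x (i+1) - x (i-1)) = 0 := by
      have : (f1 * (x (i+1) - x i) + f2 * (x i - x (i-1)) - f0 * (x (i+1) - x (i-1)))
        * (x r - x l) = 0 := by
        linear_combination (x (i+1) - x i) * e1 + (x i - x (i-1)) * e2 - (x (i+1) - x (i-1)) * e0
      exact (mul_eq_zero.1 this).resolve_right p.ne'
    rw [key, ← e0]
    rw [← e0] at hn
    refine ⟨fun hd => absurd hd (lt_irrefl _), fun hd => absurd hd (lt_irrefl _), fun _ hh => ?_,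
      fun _ hh => ?_, fun _ hh => hn (by rw [hh])⟩
    · exact mul_le_mul_of_nonneg_right hh.le p.le
    · exact not_le.2 (mul_lt_mul_of_pos_right hh p)

lemma F_le (m : ℕ) (x h : ℕ → ℝ) (hx : ∀ i j, i < j → j ≤ m → x i < x j)
    (hne : ∀ l i r, l < i → i < r → r ≤ m →
      h l * (x r - x i) + h r * (x i - x l) ≠ h i * (x r - x l))
    (S : Finset ℕ) (h0 : 0 ∈ S) (hm : m ∈ S) (hS : ∀ a ∈ S, a ≤ m)
    (T : Finset ℕ) (h0' : 0 ∈ T) (hm' : m ∈ T) (hT : ∀ a ∈ T, a ≤ m)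
    (hsig : ∀ i, 0 < i → i < m → ((i ∈ S ↔ up x h S i) ↔ (i ∈ T ↔ up x h T i)))
    (j : ℕ) (hj : j ≤ m) : F x h S j ≤ F x h T j := by
  by_contra hcon
  push Not at hcon
  obtain ⟨k, hk, hkmax⟩ := Finset.exists_max_image (Finset.range (m+1))
    (fun i => F x h S i - F x h T i) ⟨j, by simp; omega⟩
  have hex : ∃ k, k ≤ m ∧ ∀ i ≤ m, F x h S i - F x h T i ≤ F x h S k - F x h T k :=
    ⟨k, by simp at hk; omega, fun i hi => hkmax i (by simp; omega)⟩
  obtain ⟨him, hmax⟩ := Nat.find_spec hex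
  have hmin := fun k hk => Nat.find_min hex (m := k) hk
  generalize Nat.find hex = i at *
  have hpos : 0 < F x h S i - F x h T i := by linarith [hmax j hj]
  have hi0 : 0 < i := by
    rcases Nat.eq_zero_or_pos i with rfl | hh
    · rw [F_mem _ _ _ _ h0, F_mem _ _ _ _ h0'] at hpos; simp at hpos
    · exact hh
  have him' : i < m := by
    rcases him.eq_or_lt with rfl | hh
    · rw [F_mem _ _ _ _ hm, F_mem _ _ _ _ hm'] at hpos; simp at hpos
    · exact hh
  have g1 : F x h S (i-1) - F x h T (i-1) < F x h S i - F x h T i := by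
    by_contra hh
    push Not at hh
    exact hmin (i-1) (by omega) ⟨by omega, fun a ha => (hmax a ha).trans hh⟩
  have g2 := hmax (i+1) (by omega)
  have x1 := hx (i-1) i (by omega) him
  have x2 := hx i (i+1) (by omega) (by omega)
  have hD : D x (F x h S) i < D x (F x h T) i := by
    unfold D
    nlinarith [mul_pos (sub_pos.2 g1) (sub_pos.2 x2),
      mul_nonneg (sub_nonneg.2 g2) (sub_pos.2 x1).le]
  obtain ⟨s1, s2, s3, s4, s5⟩ := F_facts m x h hx hne S h0 hm hS i hi0 him'
  obtain ⟨t1, t2, t3, t4, t5⟩ := F_facts m x h hx hne T h0' hm' hT i hi0 him'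
  have hs := hsig i hi0 him'
  by_cases hneg : D x (F x h S) i < 0
  · obtain ⟨a, b⟩ := s1 hneg
    have e := F_mem x h S i a
    have : i ∉ T := fun hh => by rw [e, F_mem x h T i hh] at hpos; simp at hpos
    have hu := t3 this (by linarith)
    exact this ((hs.1 (iff_of_true a b)).2 hu)
  · obtain ⟨a, b⟩ := t2 (by linarith)
    have e := F_mem x h T i a
    have : i ∉ S := fun hh => by rw [e, F_mem x h S i hh] at hpos; simp at hpos
    have hu := s4 this (by linarith)
    exact b ((hs.1 (iff_of_false this hu)).1 a)

lemma sig_inj (m : ℕ) (x h : ℕ → ℝ) (hx : ∀ i j, i < j → j ≤ m → x i < x j)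
    (hne : ∀ l i r, l < i → i < r → r ≤ m →
      h l * (x r - x i) + h r * (x i - x l) ≠ h i * (x r - x l))
    (S : Finset ℕ) (h0 : 0 ∈ S) (hm : m ∈ S) (hS : ∀ a ∈ S, a ≤ m)
    (T : Finset ℕ) (h0' : 0 ∈ T) (hm' : m ∈ T) (hT : ∀ a ∈ T, a ≤ m)
    (hsig : ∀ i, 0 < i → i < m → ((i ∈ S ↔ up x h S i) ↔ (i ∈ T ↔ up x h T i))) :
    S = T := by
  have hF : ∀ j ≤ m, F x h S j = F x h T j := fun j hj => le_antisymm
    (F_le m x h hx hne S h0 hm hS T h0' hm' hT hsig j hj)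
    (F_le m x h hx hne T h0' hm' hT S h0 hm hS (fun i a b => (hsig i a b).symm) j hj)
  have aux : ∀ (S T : Finset ℕ), 0 ∈ T → m ∈ T → (∀ a ∈ S, a ≤ m) → (∀ a ∈ T, a ≤ m) →
      (∀ j ≤ m, F x h S j = F x h T j) → S ⊆ T := by
    intro S T h0' hm' hS hT hF i hi
    by_contra hiT
    have h1 := hS i hi
    have hi0 : 0 < i := Nat.pos_of_ne_zero (fun hh => hiT (hh ▸ h0'))
    have him : i < m := lt_of_le_of_ne h1 (fun hh => hiT (hh ▸ hm'))
    exact (F_facts m x h hx hne T h0' hm' hT i hi0 him).2.2.2.2 hiT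
      (by rw [← hF i h1, F_mem _ _ _ _ hi])
  exact Finset.Subset.antisymm (aux S T h0' hm' hS hT hF)
    (aux T S h0 hm hT hS (fun j hj => (hF j hj).symm))

/-- Determinant of two vectors based at `A`. -/
def det (A p q : ℝ × ℝ) : ℝ := (p - A).1 * (q - A).2 - (p - A).2 * (q - A).1

lemma meet_iff (A L I R : ℝ × ℝ) (h1 : 0 < det A L I) (h2 : 0 < det A I R) :
    (segment ℝ A I ∩ segment ℝ L R).Nonempty ↔ det A L R ≤ det A L I + det A I R ∧ 0 ≤ det A L R := by
  obtain ⟨a1, a2⟩ := A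
  obtain ⟨l1, l2⟩ := L
  obtain ⟨i1, i2⟩ := I
  obtain ⟨r1, r2⟩ := R
  simp only [det, Prod.mk_sub_mk] at *
  constructor
  · rintro ⟨p, ⟨s', s, hs', hs, hss, hp⟩, ⟨t', t, ht', ht, htt, hq⟩⟩
    subst hp
    simp only [Prod.smul_mk, Prod.mk_add_mk, Prod.mk.injEq, smul_eq_mul] at hq
    obtain ⟨q1, q2⟩ := hq
    obtain rfl : s' = 1 - s := by linarith
    obtain rfl : t' = 1 - t := by linarith
    have key : s * (((l1 - a1) * (i2 - a2) - (l2 - a2) * (i1 - a1)) +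
        ((i1 - a1) * (r2 - a2) - (i2 - a2) * (r1 - a1))) =
        (l1 - a1) * (r2 - a2) - (l2 - a2) * (r1 - a1) := by
      linear_combination (-(r2 - a2) + (l2 - a2)) * q1 + ((r1 - a1) - (l1 - a1)) * q2
    rw [← key]
    constructor
    · have : s ≤ 1 := by linarith
      nlinarith
    · positivity
  · rintro ⟨h, h'⟩
    set dli := (l1 - a1) * (i2 - a2) - (l2 - a2) * (i1 - a1) with e1
    set dir := (i1 - a1) * (r2 - a2) - (i2 - a2) * (r1 - a1) with e2
    set dlr := (l1 - a1) * (r2 - a2) - (l2 - a2) * (r1 - a1) with e3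
    have hp : 0 < dli + dir := by linarith
    refine ⟨(1 - dlr / (dli + dir)) • (a1, a2) + (dlr / (dli + dir)) • (i1, i2),
      ⟨_, _, ?_, by positivity, by ring, rfl⟩,
      ⟨dir / (dli + dir), dli / (dli + dir), by positivity, by positivity, by field_simp; ring, ?_⟩⟩
    · rw [sub_nonneg, div_le_one hp]; exact h
    · simp only [Prod.smul_mk, Prod.mk_add_mk, Prod.mk.injEq, smul_eq_mul]
      constructor
      · field_simp
        rw [e1, e2, e3]; ring
      · field_simp
        rw [e1, e2, e3]; ring

lemma collinear_of (A L I R : ℝ × ℝ) (h : 0 < det A L R)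
    (he : det A L R = det A L I + det A I R) : Collinear ℝ ({L, I, R} : Set (ℝ × ℝ)) := by
  rw [collinear_iff_of_mem (p₀ := L) (by simp)]
  refine ⟨R - L, ?_⟩
  rintro p (rfl | rfl | rfl)
  · exact ⟨0, by simp⟩
  · refine ⟨det A L p / det A L R, ?_⟩
    obtain ⟨a1, a2⟩ := A
    obtain ⟨l1, l2⟩ := L
    obtain ⟨i1, i2⟩ := p
    obtain ⟨r1, r2⟩ := R
    have hne := h.ne'
    have e1 : det (a1, a2) (l1, l2) (r1, r2) * (i1 - a1) =
        det (a1, a2) (i1, i2) (r1, r2) * (l1 - a1) + det (a1, a2) (l1, l2) (i1, i2) * (r1 - a1) := by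
      simp only [det, Prod.mk_sub_mk]; ring
    have e2 : det (a1, a2) (l1, l2) (r1, r2) * (i2 - a2) =
        det (a1, a2) (i1, i2) (r1, r2) * (l2 - a2) + det (a1, a2) (l1, l2) (i1, i2) * (r2 - a2) := by
      simp only [det, Prod.mk_sub_mk]; ring
    generalize det (a1, a2) (l1, l2) (r1, r2) = u at *
    generalize det (a1, a2) (l1, l2) (i1, i2) = v at *
    generalize det (a1, a2) (i1, i2) (r1, r2) = w at *
    simp only [Prod.mk_sub_mk, Prod.smul_mk, vadd_eq_add, Prod.mk_add_mk, Prod.mk.injEq, smul_eq_mul]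
    constructor
    · field_simp
      linear_combination e1 + (a1 - l1) * he
    · field_simp
      linear_combination e2 + (a2 - l2) * he
  · exact ⟨1, by simp⟩

/-- Projective coordinates sending `A` to infinity. -/
lemma coords (m : ℕ) (hm : 0 < m) (A : ℝ × ℝ) (P : ℕ → ℝ × ℝ)
    (hd : ∀ i j, i < j → j ≤ m → 0 < det A (P i) (P j)) :
    ∃ x h : ℕ → ℝ, (∀ i j, i < j → j ≤ m → x i < x j) ∧
      ∀ l i r, l < i → i < r → r ≤ m → ∃ c : ℝ, 0 < c ∧
        h i * (x r - x l) - (h l * (x r - x i) + h r * (x i - x l)) =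
          c * (det A (P l) (P i) + det A (P i) (P r) - det A (P l) (P r)) := by
  set y : ℕ → ℝ := fun i => det A (P 0) (P i) + det A (P i) (P m) with hy
  have ypos : ∀ i ≤ m, 0 < y i := by
    intro i hi
    have self : ∀ p, det A p p = 0 := fun p => by simp only [det]; ring
    simp only [hy]
    rcases Nat.eq_zero_or_pos i with rfl | h0
    · rw [self]; linarith [hd 0 m hm le_rfl]
    rcases hi.eq_or_lt with rfl | h1
    · rw [self]; linarith [hd 0 i hm le_rfl]
    · linarith [hd 0 i h0 hi, hd i m h1 le_rfl]
  have hc := hd 0 m hm le_rfl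
  have diff : ∀ i j, i ≤ m → j ≤ m → det A (P 0) (P j) / y j - det A (P 0) (P i) / y i
      = det A (P 0) (P m) * det A (P i) (P j) / (y i * y j) := by
    intro i j hi hj
    have h1 := (ypos i hi).ne'
    have h2 := (ypos j hj).ne'
    have : det A (P 0) (P j) * y i - det A (P 0) (P i) * y j =
        det A (P 0) (P m) * det A (P i) (P j) := by
      simp only [hy, det]; ring
    field_simp
    linear_combination this
  refine ⟨fun i => det A (P 0) (P i) / y i, fun i => - (1 / y i), ?_, ?_⟩
  · intro i j hij hj
    have := diff i j (by omega) hj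
    have h1 := ypos i (by omega)
    have h2 := ypos j hj
    have h3 := hd i j hij hj
    have : 0 < det A (P 0) (P m) * det A (P i) (P j) / (y i * y j) := by positivity
    simp only
    linarith
  · intro l i r hl hr hrm
    have h1 := ypos l (by omega)
    have h2 := ypos i (by omega)
    have h3 := ypos r (by omega)
    refine ⟨det A (P 0) (P m) / (y l * y i * y r), by positivity, ?_⟩
    simp only
    rw [diff l r (by omega) (by omega), diff i r (by omega) (by omega),
      diff l i (by omega) (by omega)]
    field_simp
    ring

lemma card_aux (n : ℕ) (hn : 4 ≤ n) :
    ∃ e : Finset ℕ → (Set.Icc 1 (n - 3) → ℤ),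
    Set.BijOn e {S : Finset ℕ | ↑S ⊆ Set.Iio (n - 1) ∧ 0 ∈ S ∧ n - 2 ∈ S}
      {σ : Set.Icc 1 (n - 3) → ℤ | ∀ i, σ i = 1 ∨ σ i = -1} := by
  refine ⟨fun S i => if (i : ℕ) ∈ S then 1 else -1, ?_, ?_, ?_⟩
  · intro S _ i
    simp only
    split_ifs <;> simp
  · rintro S ⟨h1, h2, h3⟩ T ⟨h1', h2', h3'⟩ he
    ext i
    by_cases hi : 1 ≤ i ∧ i ≤ n - 3
    · have := congrFun he ⟨i, hi⟩
      simp only at this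
      by_cases a : i ∈ S <;> by_cases b : i ∈ T <;> simp_all
    · by_cases h0 : i = 0
      · subst h0; simp [h2, h2']
      by_cases h4 : i = n - 2
      · subst h4; simp [h3, h3']
      · constructor
        · intro hh; have := h1 hh; simp only [Set.mem_Iio] at this; omega
        · intro hh; have := h1' hh; simp only [Set.mem_Iio] at this; omega
  · intro σ hσ
    refine ⟨(Finset.range (n-1)).filter
      (fun i => i = 0 ∨ i = n - 2 ∨ ∃ h : i ∈ Set.Icc 1 (n-3), σ ⟨i, h⟩ = 1), ⟨?_, ?_, ?_⟩, ?_⟩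
    · intro i hi; simp at hi; exact hi.1
    · simp; omega
    · simp; omega
    · funext ⟨i, hi⟩
      have hi' := hi
      simp only [Set.mem_Icc] at hi'
      have a1 : i < n - 1 := by omega
      have a2 : i ≠ 0 := by omega
      have a3 : i ≠ n - 2 := by omega
      rcases hσ ⟨i, hi⟩ with h | h
      · simp [h, a1, hi'.1, hi'.2]
      · simp [h, a2, a3]

end PolySig

/-- **Lemma (signatures of A-monotone polylines).**
Let `𝒜 ⊆ ℝ²` be a set of `n ≥ 4` points in general position (no three collinear),
let `A ∈ 𝒜` be an extreme point of `conv 𝒜`, and let `P 0, …, P (n−2)` enumerate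
`𝒜 \ {A}` in counterclockwise angular order as seen from `A` (i.e. for `i < j < n−1`
the determinant of `(P i − A, P j − A)` is positive).  To every subset
`S ⊆ {0, …, n−2}` with `0, n−2 ∈ S` associate the sign vector
`σ_S : {1, …, n−3} → {−1, +1}` where, with `a_l = max {a ∈ S | a < i}` and
`a_r = min {a ∈ S | i < a}`, we set `σ_S i = +1` iff either (`i ∈ S` and the segments
`[A, P i]` and `[P a_l, P a_r]` meet) or (`i ∉ S` and these segments do not meet).
Then `S ↦ σ_S` is a bijection from the subsets of `{0, …, n−2}` containing `0` and
`n−2` onto the set of all sign vectors `{−1, +1}^{{1,…,n−3}}`. -/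
theorem polyline_signature_bijection
    (n : ℕ) (hn : 4 ≤ n)
    (𝒜 : Finset (ℝ × ℝ)) (hcard : 𝒜.card = n)
    (hgp : ∀ p ∈ 𝒜, ∀ q ∈ 𝒜, ∀ r ∈ 𝒜, p ≠ q → p ≠ r → q ≠ r →
      ¬ Collinear ℝ ({p, q, r} : Set (ℝ × ℝ)))
    (A : ℝ × ℝ) (hA : A ∈ 𝒜)
    (hAext : A ∉ convexHull ℝ ((𝒜.erase A : Finset (ℝ × ℝ)) : Set (ℝ × ℝ)))
    (P : ℕ → ℝ × ℝ)
    (hP : Set.BijOn P (Set.Iio (n - 1)) ((𝒜.erase A : Finset (ℝ × ℝ)) : Set (ℝ × ℝ)))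
    (hccw : ∀ i j : ℕ, i < j → j < n - 1 →
      0 < (P i - A).1 * (P j - A).2 - (P i - A).2 * (P j - A).1) :
    Set.BijOn
      (fun (S : Finset ℕ) (i : Set.Icc 1 (n - 3)) =>
        let a_l : ℕ := sSup {a ∈ (S : Set ℕ) | a < (i : ℕ)}
        let a_r : ℕ := sInf {a ∈ (S : Set ℕ) | (i : ℕ) < a}
        if ((i : ℕ) ∈ S ↔
            (segment ℝ A (P i) ∩ segment ℝ (P a_l) (P a_r)).Nonempty)
          then (1 : ℤ) else -1)
      {S : Finset ℕ | ↑S ⊆ Set.Iio (n - 1) ∧ 0 ∈ S ∧ n - 2 ∈ S}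
      {σ : Set.Icc 1 (n - 3) → ℤ | ∀ i, σ i = 1 ∨ σ i = -1} := by
  have hd : ∀ i j, i < j → j ≤ n - 2 → 0 < PolySig.det A (P i) (P j) :=
    fun i j hij hj => hccw i j hij (by omega)
  have hne : ∀ l i r, l < i → i < r → r ≤ n - 2 →
      PolySig.det A (P l) (P r) ≠ PolySig.det A (P l) (P i) + PolySig.det A (P i) (P r) := by
    intro l i r hl hr hrm he
    have hmem : ∀ j ≤ n - 2, P j ∈ 𝒜 := fun j hj => by
      have := hP.mapsTo (show j ∈ Set.Iio (n-1) by simp only [Set.mem_Iio]; omega)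
      exact Finset.mem_of_mem_erase (Finset.mem_coe.1 this)
    have hinj : ∀ j k, j < k → k ≤ n - 2 → P j ≠ P k := fun j k hjk hk hh => by
      have := hP.injOn (show j ∈ Set.Iio (n-1) by simp only [Set.mem_Iio]; omega)
        (show k ∈ Set.Iio (n-1) by simp only [Set.mem_Iio]; omega) hh
      omega
    exact hgp (P l) (hmem l (by omega)) (P i) (hmem i (by omega)) (P r) (hmem r hrm)
      (hinj l i hl (by omega)) (hinj l r (by omega) hrm) (hinj i r hr hrm)
      (PolySig.collinear_of A _ _ _ (hd l r (by omega) hrm) he)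
  obtain ⟨x, h, hx, hc⟩ := PolySig.coords (n-2) (by omega) A P hd
  have hne' : ∀ l i r, l < i → i < r → r ≤ n - 2 →
      h l * (x r - x i) + h r * (x i - x l) ≠ h i * (x r - x l) := by
    intro l i r hl hr hrm he
    obtain ⟨c, hc0, hc1⟩ := hc l i r hl hr hrm
    rw [he, sub_self] at hc1
    have := (mul_eq_zero.1 hc1.symm).resolve_left hc0.ne'
    exact hne l i r hl hr hrm (by linarith)
  have hup : ∀ S : Finset ℕ, 0 ∈ S → n - 2 ∈ S → (∀ a ∈ S, a ≤ n - 2) → ∀ i, 0 < i → i < n - 2 →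
      ((segment ℝ A (P i) ∩ segment ℝ (P (PolySig.aL S i)) (P (PolySig.aR S i))).Nonempty ↔
        PolySig.up x h S i) := by
    intro S h0 hm hS i hi him
    obtain ⟨l1, l2, l3⟩ := PolySig.aL_spec S i h0 hi
    obtain ⟨r1, r2, r3⟩ := PolySig.aR_spec S i _ hm him
    have hrm := hS _ r1
    obtain ⟨c, hc0, hc1⟩ := hc _ i _ l2 r2 hrm
    rw [PolySig.meet_iff A _ _ _ (hd _ _ l2 him.le) (hd _ _ r2 hrm)]
    have h3 := hd _ _ (l2.trans r2) hrm
    unfold PolySig.up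
    rw [← sub_nonneg (b := h (PolySig.aL S i) * _ + _), hc1, mul_nonneg_iff_of_pos_left hc0,
      sub_nonneg]
    exact and_iff_left h3.le
  obtain ⟨e, he⟩ := PolySig.card_aux n hn
  have hmaps : Set.MapsTo (fun (S : Finset ℕ) (i : Set.Icc 1 (n - 3)) =>
        let a_l : ℕ := sSup {a ∈ (S : Set ℕ) | a < (i : ℕ)}
        let a_r : ℕ := sInf {a ∈ (S : Set ℕ) | (i : ℕ) < a}
        if ((i : ℕ) ∈ S ↔
            (segment ℝ A (P i) ∩ segment ℝ (P a_l) (P a_r)).Nonempty)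
          then (1 : ℤ) else -1)
      {S : Finset ℕ | ↑S ⊆ Set.Iio (n - 1) ∧ 0 ∈ S ∧ n - 2 ∈ S}
      {σ : Set.Icc 1 (n - 3) → ℤ | ∀ i, σ i = 1 ∨ σ i = -1} := by
    intro S _ i
    simp only
    split_ifs <;> simp
  have hfin : {S : Finset ℕ | (S : Set ℕ) ⊆ Set.Iio (n - 1) ∧ 0 ∈ S ∧ n - 2 ∈ S}.Finite := by
    refine (Finset.finite_toSet (Finset.range (n-1)).powerset).subset ?_
    rintro S ⟨h1, -⟩
    simp only [Finset.coe_powerset, Set.mem_preimage, Set.mem_powerset_iff, Finset.coe_range]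
    exact h1
  have hinj : Set.InjOn (fun (S : Finset ℕ) (i : Set.Icc 1 (n - 3)) =>
        let a_l : ℕ := sSup {a ∈ (S : Set ℕ) | a < (i : ℕ)}
        let a_r : ℕ := sInf {a ∈ (S : Set ℕ) | (i : ℕ) < a}
        if ((i : ℕ) ∈ S ↔
            (segment ℝ A (P i) ∩ segment ℝ (P a_l) (P a_r)).Nonempty)
          then (1 : ℤ) else -1)
      {S : Finset ℕ | ↑S ⊆ Set.Iio (n - 1) ∧ 0 ∈ S ∧ n - 2 ∈ S} := by
    rintro S ⟨h1, h2, h3⟩ T ⟨h1', h2', h3'⟩ heq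
    have hS : ∀ a ∈ S, a ≤ n - 2 := fun a ha => by
      have := h1 ha; simp only [Set.mem_Iio] at this; omega
    have hT : ∀ a ∈ T, a ≤ n - 2 := fun a ha => by
      have := h1' ha; simp only [Set.mem_Iio] at this; omega
    refine PolySig.sig_inj (n-2) x h hx hne' S h2 h3 hS T h2' h3' hT ?_
    intro i hi him
    have hh := congrFun heq ⟨i, by simp only [Set.mem_Icc]; omega⟩
    rw [← hup S h2 h3 hS i hi him, ← hup T h2' h3' hT i hi him]
    simp only [PolySig.aL, PolySig.aR]
    simp only at hh
    split_ifs at hh with u v v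
    all_goals first
      | exact iff_of_true u v
      | exact iff_of_false u v
      | (exfalso; norm_num at hh; done)
  refine ⟨hmaps, hinj, ?_⟩
  have htfin : {σ : Set.Icc 1 (n - 3) → ℤ | ∀ i, σ i = 1 ∨ σ i = -1}.Finite := by
    rw [← he.image_eq]; exact hfin.image e
  have := Set.eq_of_subset_of_ncard_le hmaps.image_subset (by
    rw [Set.ncard_image_of_injOn hinj, ← he.image_eq, Set.ncard_image_of_injOn he.injOn]) htfin
  exact this.ge
end
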